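/- Let F be a finite field with q elements, k, m, n positive integers with k ≤ min(m,n), and λ a natural number. Let 𝒜 ⊆ F^{m×n} be a subset such that for every matrix M ∈ F^{k×m} of rank k and every K ∈ F^{k×n}, |{X ∈ 𝒜 : M*X = K}| = λ (i.e. 𝒜 meets every (m−k)-flat of the right affine matrix geometry in exactly λ points). Then for every matrix N ∈ F^{n×k} of rank k and every L ∈ F^{m×k}, |{X ∈ 𝒜 : X*N = L}| = λ · q^{k(n−m)} (i.e. 𝒜 meets every (n−k)-flat of the left affine matrix geometry in the same number λ·q^{k(n−m)} of points). -/

import Mathlib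

open Matrix

lemma aux_factor {F : Type*} [Field F] (k m : ℕ) (hkm : k ≤ m)
    (W : Matrix (Fin k) (Fin m) F) :
    ∃ (P : Matrix (Fin k) (Fin k) F) (M : Matrix (Fin k) (Fin m) F), M.rank = k ∧ W = P * M := by
  obtain ⟨b, hbt, hbs, hbi⟩ := exists_linearIndependent F (Set.range W.row)
  have hb : LinearIndepOn F id b := hbi
  have hbfin : b.Finite := (Set.finite_range W.row).subset hbt
  have hbc : b.ncard ≤ k := by
    refine (Set.ncard_le_ncard hbt (Set.finite_range _)).trans ?_
    rw [← Set.image_univ]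
    refine (Set.ncard_image_le Set.finite_univ).trans ?_
    simp [Set.ncard_univ]
  let B := Module.Basis.extend hb
  have hcard : (hb.extend (Set.subset_univ b)).ncard = m := by
    have := Module.finrank_eq_nat_card_basis B
    rw [Module.finrank_fin_fun] at this
    exact this.symm
  obtain ⟨u, hbu, hut, hu⟩ := Set.exists_subsuperset_card_eq (hb.subset_extend (Set.subset_univ b))
    hbc (by rw [hcard]; exact hkm)
  have hui : LinearIndepOn F id u := (hb.linearIndepOn_extend _).mono hut
  have hufin : u.Finite := hui.linearIndependent.setFinite
  have := hufin.to_subtype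
  let e : Fin k ≃ u := (Finite.equivFinOfCardEq (by rw [← hu]; rfl)).symm
  let M : Matrix (Fin k) (Fin m) F := Matrix.of fun i => (e i : Fin m → F)
  have hMi : LinearIndependent F M.row :=
    hui.linearIndependent.comp e e.injective
  have hrange : Set.range M.row = u := by
    ext x; constructor
    · rintro ⟨i, rfl⟩; exact (e i).2
    · intro hx; exact ⟨e.symm ⟨x, hx⟩, congrArg Subtype.val (e.apply_symm_apply ⟨x, hx⟩)⟩
  have hmem : ∀ i, ∃ c : Fin k → F, ∑ j, c j • M.row j = W.row i := by
    intro i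
    rw [← Submodule.mem_span_range_iff_exists_fun, hrange]
    apply Submodule.span_mono hbu
    rw [hbs]
    exact Submodule.subset_span ⟨i, rfl⟩
  choose P hP using hmem
  refine ⟨Matrix.of P, M, by simpa using hMi.rank_matrix, ?_⟩
  ext i j
  have := congrFun (hP i) j
  simp only [Finset.sum_apply, Pi.smul_apply, smul_eq_mul, Matrix.row] at this
  rw [Matrix.mul_apply]
  exact this.symm

lemma aux_orth {F : Type*} [Field F] [Fintype F] [DecidableEq F] (ψ : AddChar F ℂ)
    (hψ : ψ.IsPrimitive) (a b : ℕ) (W : Matrix (Fin a) (Fin b) F) (hW : W ≠ 0) :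
    ∑ K : Matrix (Fin b) (Fin a) F, ψ (W * K).trace = 0 := by
  let φ : Matrix (Fin b) (Fin a) F →+ F :=
    { toFun := fun K => (W * K).trace
      map_zero' := by simp
      map_add' := by intro x y; simp [Matrix.mul_add] }
  have hne : ψ.compAddMonoidHom φ ≠ 0 := by
    obtain ⟨i, j, hij⟩ : ∃ i j, W i j ≠ 0 := by
      by_contra! hc
      exact hW (by ext i j; exact hc i j)
    obtain ⟨c, hc⟩ := AddChar.ne_one_iff.1 (hψ hij)
    refine AddChar.ne_zero_iff.2 ⟨Matrix.single j i c, ?_⟩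
    have : φ (Matrix.single j i c) = W i j * c := by
      change (W * Matrix.single j i c).trace = _
      rw [Matrix.trace_mul_single]
      simp
    rw [AddChar.compAddMonoidHom_apply, this]
    simpa [AddChar.mulShift_apply] using hc
  exact (AddChar.sum_eq_zero_iff_ne_zero).2 hne

lemma aux_card {F : Type*} [Field F] [Fintype F] [DecidableEq F] (a b : ℕ) :
    Fintype.card (Matrix (Fin a) (Fin b) F) = Fintype.card F ^ (a * b) := by
  have h1 : Fintype.card (Matrix (Fin a) (Fin b) F) = Fintype.card (Fin a → Fin b → F) :=
    Fintype.card_congr Matrix.of.symm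
  rw [h1]
  simp only [Fintype.card_fun, Fintype.card_fin]
  rw [← pow_mul, mul_comm]

/-- If `𝒜 ⊆ F^{m×n}` meets every `(m−k)`-flat of the right affine matrix geometry
(the cosets `{X : M*X = K}` with `M ∈ F^{k×m}` of rank `k`) in exactly `λ` points, then
`𝒜` meets every `(n−k)`-flat of the left affine matrix geometry (the cosets
`{X : X*N = L}` with `N ∈ F^{n×k}` of rank `k`) in exactly `λ·q^{k(n−m)}` points. -/
theorem stmt17 {F : Type*} [Field F] [Fintype F] [DecidableEq F] (q k m n lam : ℕ)
    (hq : Fintype.card F = q) (hk : 0 < k) (hkm : k ≤ m) (hkn : k ≤ n)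
    (𝒜 : Set (Matrix (Fin m) (Fin n) F))
    (h : ∀ M : Matrix (Fin k) (Fin m) F, M.rank = k →
      ∀ K : Matrix (Fin k) (Fin n) F, {X ∈ 𝒜 | M * X = K}.ncard = lam) :
    ∀ N : Matrix (Fin n) (Fin k) F, N.rank = k →
      ∀ L : Matrix (Fin m) (Fin k) F,
        ({X ∈ 𝒜 | X * N = L}.ncard : ℝ)
          = (lam : ℝ) * (q : ℝ) ^ ((k : ℤ) * ((n : ℤ) - (m : ℤ))) := by
  classical
  intro N hN L
  let ψ : AddChar F ℂ := AddChar.FiniteField.primitiveChar_to_Complex F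
  have hψ : ψ.IsPrimitive := AddChar.FiniteField.primitiveChar_to_Complex_isPrimitive F
  let S : Finset (Matrix (Fin m) (Fin n) F) := Finset.univ.filter (· ∈ 𝒜)
  have hfib : ∀ M : Matrix (Fin k) (Fin m) F, M.rank = k → ∀ K : Matrix (Fin k) (Fin n) F,
      (S.filter (fun X => M * X = K)).card = lam := by
    intro M hM K
    rw [← h M hM K, ← Set.ncard_coe_finset]
    congr 1
    ext X; simp [S]
  have hT : ({X ∈ 𝒜 | X * N = L}.ncard) = (S.filter (fun X => X * N = L)).card := by
    rw [← Set.ncard_coe_finset]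
    congr 1
    ext X; simp [S]
  have hgroup : ∀ M : Matrix (Fin k) (Fin m) F, M.rank = k →
      ∀ f : Matrix (Fin k) (Fin n) F → ℂ, ∑ X ∈ S, f (M * X) = lam * ∑ K, f K := by
    intro M hM f
    rw [← Finset.sum_fiberwise S (fun X => M * X), Finset.mul_sum]
    refine Finset.sum_congr rfl fun K _ => ?_
    rw [Finset.sum_congr rfl (g := fun _ => f K)]
    · rw [Finset.sum_const, hfib M hM K, nsmul_eq_mul]
    · intro X hX
      rw [(Finset.mem_filter.1 hX).2]
  have hScard : (S.card : ℂ) = lam * (q : ℂ) ^ (k * n) := by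
    obtain ⟨P, M, hM, -⟩ := aux_factor k m hkm (0 : Matrix (Fin k) (Fin m) F)
    have := hgroup M hM (fun _ => 1)
    simp only [Finset.sum_const, nsmul_eq_mul, mul_one, Finset.card_univ, aux_card, hq] at this
    rw [this]; push_cast; rfl
  have hNinj : ∀ W : Matrix (Fin k) (Fin m) F, N * W = 0 → W = 0 := by
    intro W hW
    have hli : LinearIndependent F N.col := by
      rw [linearIndependent_iff_card_eq_finrank_span, Set.finrank, ← Matrix.rank_eq_finrank_span_cols, hN]
      simp
    have hinj := Matrix.mulVec_injective_iff.2 hli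
    ext i j
    have : N *ᵥ (W.col j) = N *ᵥ 0 := by
      rw [Matrix.mulVec_zero]
      ext i'
      exact congrFun (congrFun hW i') j
    exact congrFun (hinj this) i
  have hvan : ∀ W : Matrix (Fin k) (Fin m) F, W ≠ 0 →
      ∑ X ∈ S, ψ (W * (X * N)).trace = 0 := by
    intro W hW
    obtain ⟨P, M, hM, hPM⟩ := aux_factor k m hkm W
    have hNP : N * P ≠ 0 := by
      intro h0
      apply hW
      apply hNinj
      rw [hPM, ← Matrix.mul_assoc, h0, Matrix.zero_mul]
    have := hgroup M hM (fun K => ψ ((N * P) * K).trace)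
    rw [aux_orth ψ hψ _ _ _ hNP, mul_zero] at this
    rw [← this]
    refine Finset.sum_congr rfl fun X _ => ?_
    congr 1
    rw [← Matrix.mul_assoc, Matrix.trace_mul_comm, hPM]
    simp only [Matrix.mul_assoc]
  have hind : ∀ Y : Matrix (Fin m) (Fin k) F,
      ∑ W : Matrix (Fin k) (Fin m) F, ψ (W * Y).trace
        = if Y = 0 then (q : ℂ) ^ (k * m) else 0 := by
    intro Y
    split_ifs with hY
    · subst hY
      simp [aux_card, hq]
    · rw [← aux_orth ψ hψ _ _ Y hY]
      refine Finset.sum_congr rfl fun W _ => ?_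
      rw [Matrix.trace_mul_comm]
  have key : ((S.filter (fun X => X * N = L)).card : ℂ) * (q : ℂ) ^ (k * m)
      = lam * (q : ℂ) ^ (k * n) := by
    have h1 : ∑ X ∈ S, ∑ W : Matrix (Fin k) (Fin m) F, ψ (W * (X * N - L)).trace
        = ((S.filter (fun X => X * N = L)).card : ℂ) * (q : ℂ) ^ (k * m) := by
      simp only [hind, sub_eq_zero]
      rw [← Finset.sum_filter, Finset.sum_const, nsmul_eq_mul]
    rw [← h1, Finset.sum_comm, Finset.sum_eq_single (0 : Matrix (Fin k) (Fin m) F)]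
    · simp [hScard]
    · intro W _ hW
      have : ∀ X : Matrix (Fin m) (Fin n) F, ψ (W * (X * N - L)).trace
          = ψ (W * (X * N)).trace * ψ (-(W * L).trace) := by
        intro X
        rw [← AddChar.map_add_eq_mul, Matrix.mul_sub, Matrix.trace_sub, sub_eq_add_neg]
      simp only [this]
      rw [← Finset.sum_mul, hvan W hW, zero_mul]
    · intro h0; exact absurd (Finset.mem_univ _) h0
  have keyR : ((S.filter (fun X => X * N = L)).card : ℝ) * (q : ℝ) ^ (k * m)
      = lam * (q : ℝ) ^ (k * n) := by exact_mod_cast key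
  have hq0 : (q : ℝ) ≠ 0 := by
    rw [← hq]; exact_mod_cast Fintype.card_ne_zero
  rw [hT, mul_sub, zpow_sub₀ hq0, ← mul_div_assoc, eq_div_iff (zpow_ne_zero _ hq0)]
  exact_mod_cast keyR
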